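/- Let (R, 𝔪) be a commutative Noetherian local ring and r ≥ 1. Let S = ⊕_{n∈ℕ^r} S_n be a Noetherian standard ℕ^r-graded ring with S_0 = R, and let ℳ = ⊕_{n∈ℤ^r} ℳ_n be a finitely generated ℤ^r-graded S-module. Let f : K → L be an R-linear map between finitely generated R-modules and let F denote the associated coherent functor, F(X) := Hom_R(K,X) / {g ∘ f : g ∈ Hom_R(L,X)}. Then the injective dimension of F(ℳ_n) is eventually constant: there exists c ∈ ℕ^r such that for all n ∈ ℤ^r with n ≥ c, id_R(F(ℳ_n)) = id_R(F(ℳ_c)) as elements of ℕ ∪ {∞}. -/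

import Mathlib

universe u

open CategoryTheory

/-- The value of the coherent functor presented by `f : K →ₗ[R] L` on a module `X`:
`F(X) = Hom_R(K, X) / {g ∘ f : g ∈ Hom_R(L, X)}`. -/
abbrev coherentApply {R K L : Type u} [CommRing R] [AddCommGroup K] [Module R K]
    [AddCommGroup L] [Module R L] (f : K →ₗ[R] L)
    (X : Type u) [AddCommGroup X] [Module R X] : Type u :=
  (K →ₗ[R] X) ⧸ LinearMap.range (LinearMap.lcomp R X f)

/-- The injective dimension `id_R(X) ∈ ℕ ∪ {∞}` of an `R`-module `X`: the least
`m ∈ ℕ` such that `Ext_R^{m+1}(Y, X) = 0` for every `R`-module `Y` (equivalently, the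
least length of an injective resolution of `X`), and `⊤` if there is no such `m`. -/
noncomputable def injDim (R : Type u) [CommRing R]
    (X : Type u) [AddCommGroup X] [Module R X] : ℕ∞ :=
  sInf {n : ℕ∞ | ∃ m : ℕ, n = m ∧ ∀ Y : ModuleCat.{u} R,
    Subsingleton ↥(((Ext R (ModuleCat.{u} R) (m + 1)).obj
      (Opposite.op Y)).obj (ModuleCat.of R X))}

set_option linter.unusedSectionVars false
section graded
variable {R : Type u} [CommRing R] [IsNoetherianRing R]
    {r : ℕ} 
    {S : Type u} [CommRing S] [Algebra R S] [IsNoetherianRing S]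
    (𝒜 : (Fin r → ℕ) → Submodule R S) [GradedAlgebra 𝒜]
    {ℳ : Type u} [AddCommGroup ℳ] [Module R ℳ] [Module S ℳ]
    [IsScalarTower R S ℳ] 
    (ℬ : (Fin r → ℤ) → Submodule R ℳ) [DirectSum.Decomposition ℬ]

/-- projection to a component -/
noncomputable def gproj (n : Fin r → ℤ) : ℳ →ₗ[R] ℬ n :=
  (DirectSum.component R _ (fun i => ℬ i) n) ∘ₗ (DirectSum.decomposeLinearEquiv ℬ).toLinearMap

lemma gproj_same {n : Fin r → ℤ} (x : ℳ) (hx : x ∈ ℬ n) : (gproj ℬ n x : ℳ) = x := by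
  exact DirectSum.decompose_of_mem_same ℬ hx

lemma gproj_ne {n m : Fin r → ℤ} (x : ℳ) (hx : x ∈ ℬ n) (h : n ≠ m) : gproj ℬ m x = 0 := by
  apply Subtype.ext
  exact DirectSum.decompose_of_mem_ne ℬ hx h

lemma gproj_smul
    (hsmul : ∀ (m : Fin r → ℕ) (n : Fin r → ℤ) (s : S) (x : ℳ),
      s ∈ 𝒜 m → x ∈ ℬ n → s • x ∈ ℬ (fun i => n i + m i))
    (d : Fin r → ℤ) (m : Fin r → ℕ) (s : S) (x : ℳ) (hx : x ∈ ℬ d) (n : Fin r → ℤ)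
    (hn : n = fun i => d i + m i) :
    gproj ℬ n (s • x) = gproj ℬ n ((DirectSum.decompose 𝒜 s m : S) • x) := by
  classical
  subst hn
  induction s using DirectSum.Decomposition.inductionOn 𝒜 with
  | zero => simp
  | @homogeneous m' s =>
    by_cases h : m' = m
    · subst h; simp
    · rw [DirectSum.decompose_of_mem_ne 𝒜 s.2 h, zero_smul, map_zero]
      refine gproj_ne ℬ _ (hsmul m' d s x s.2 hx) ?_
      intro h'
      apply h
      ext i
      have := congrFun h' i
      simpa using this
  | add a b ha hb => 
    rw [add_smul, map_add, ha, hb, DirectSum.decompose_add]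
    simp [add_smul]

lemma comp_noetherian [Module.Finite S ℳ] (h0 : 𝒜 0 = 1)
    (hsmul : ∀ (m : Fin r → ℕ) (n : Fin r → ℤ) (s : S) (x : ℳ),
      s ∈ 𝒜 m → x ∈ ℬ n → s • x ∈ ℬ (fun i => n i + m i)) (n : Fin r → ℤ) :
    IsNoetherian R (ℬ n) := by
  have hN : IsNoetherian S ℳ := inferInstance
  have key : ∀ N : Submodule R (ℬ n), ∀ x : ℬ n,
      (x : ℳ) ∈ Submodule.span S ((fun y : ℬ n => (y : ℳ)) '' (N : Set (ℬ n))) → x ∈ N := by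
    intro N x hx
    have gen : ∀ y : ℳ, y ∈ Submodule.span S ((fun y : ℬ n => (y : ℳ)) '' (N : Set (ℬ n))) →
        gproj ℬ n y ∈ N := by
      intro y hy
      induction hy using Submodule.closure_induction with
      | zero => simp
      | add a b _ _ ha hb => rw [map_add]; exact N.add_mem ha hb
      | smul_mem s y hy =>
        obtain ⟨z, hz, rfl⟩ := hy
        rw [gproj_smul 𝒜 ℬ hsmul n 0 s z z.2 n (by simp)]
        have h1 : (DirectSum.decompose 𝒜 s 0 : S) ∈ (1 : Submodule R S) := by
          rw [← h0]; exact SetLike.coe_mem _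
        obtain ⟨c, hc⟩ := Submodule.mem_one.1 h1
        rw [← hc, algebraMap_smul, map_smul]
        have : gproj ℬ n (z : ℳ) = z := Subtype.ext (gproj_same ℬ _ z.2)
        rw [this]
        exact N.smul_mem _ hz
    have := gen x hx
    rwa [show gproj ℬ n (x : ℳ) = x from Subtype.ext (gproj_same ℬ _ x.2)] at this
  let e : Submodule R (ℬ n) ↪o Submodule S ℳ := OrderEmbedding.ofMapLEIff
    (fun N => Submodule.span S ((fun y : ℬ n => (y : ℳ)) '' (N : Set (ℬ n)))) (by
      intro N N'
      constructor
      · intro h x hx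
        exact key N' x (h (Submodule.subset_span ⟨x, hx, rfl⟩))
      · intro h
        exact Submodule.span_mono (Set.image_mono h))
  rw [isNoetherian_iff']
  have : WellFoundedGT (Submodule S ℳ) := inferInstance
  exact e.wellFoundedGT

/-- eventual constancy of a predicate on `ℤ^r` -/
def EvConst (P : (Fin r → ℤ) → Prop) : Prop :=
  ∃ c : Fin r → ℕ, ∀ n : Fin r → ℤ, (fun i => (c i : ℤ)) ≤ n → (P n ↔ P (fun i => (c i : ℤ)))

lemma core [Module.Finite S ℳ]
    (hstd : ∀ n : Fin r → ℕ, 𝒜 n = ∏ i, 𝒜 (Pi.single i 1) ^ n i)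
    (hsmul : ∀ (m : Fin r → ℕ) (n : Fin r → ℤ) (s : S) (x : ℳ),
      s ∈ 𝒜 m → x ∈ ℬ n → s • x ∈ ℬ (fun i => n i + m i))
    (K : Type u) [AddCommGroup K] [Module R K] [Module.Finite R K]
    (q p : ∀ (X : Type u) [AddCommGroup X] [Module R X], Submodule R (K →ₗ[R] X))
    (hq : ∀ (X Y : Type u) [AddCommGroup X] [Module R X] [AddCommGroup Y] [Module R Y]
      (φ : X →ₗ[R] Y) (w : K →ₗ[R] X), w ∈ q X → φ ∘ₗ w ∈ q Y)
    (hp : ∀ (X Y : Type u) [AddCommGroup X] [Module R X] [AddCommGroup Y] [Module R Y]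
      (φ : X →ₗ[R] Y) (w : K →ₗ[R] X), w ∈ p X → φ ∘ₗ w ∈ p Y) :
    EvConst (fun n => q (ℬ n) ≤ p (ℬ n)) := by
  classical
  have hadd : ∀ a b, 𝒜 (a + b) = 𝒜 a * 𝒜 b := by
    intro a b
    rw [hstd, hstd a, hstd b, ← Finset.prod_mul_distrib]
    simp [pow_add]
  have : SMulCommClass R S ℳ := inferInstance
  -- Hom is noetherian
  have hN : IsNoetherian S (K →ₗ[R] ℳ) := by
    obtain ⟨a, g, hg⟩ := Module.Finite.exists_fin (R := R) (M := K)
    let ev : (K →ₗ[R] ℳ) →ₗ[S] (Fin a → ℳ) :=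
      { toFun := fun w i => w (g i)
        map_add' := fun _ _ => rfl
        map_smul' := fun _ _ => rfl }
    refine isNoetherian_of_injective ev ?_
    intro w w' h
    apply LinearMap.ext_on_range hg
    intro i
    exact congrFun h i
  let G : Set (K →ₗ[R] ℳ) := {w | ∃ d, ∃ v ∈ q (ℬ d), w = (ℬ d).subtype ∘ₗ v}
  obtain ⟨T, hTG, hT⟩ := Submodule.fg_span_iff_fg_span_finset_subset G |>.1
    (IsNoetherian.noetherian (Submodule.span S G))
  choose! deg v hv hvw using (fun w (hw : w ∈ G) => hw)
  -- bound of degrees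
  let c : Fin r → ℕ := fun i => T.sup (fun t => (deg t i).toNat)
  have hc : ∀ t ∈ T, ∀ i, deg t i ≤ c i := by
    intro t ht i
    have : (deg t i).toNat ≤ c i := Finset.le_sup (f := fun t => (deg t i).toNat) ht
    omega
  have up : ∀ n n' : Fin r → ℤ, (fun i => (c i : ℤ)) ≤ n → n ≤ n' →
      q (ℬ n) ≤ p (ℬ n) → q (ℬ n') ≤ p (ℬ n') := by
    intro n n' hcn hnn' h w hw
    have hwG : (ℬ n').subtype ∘ₗ w ∈ Submodule.span S (T : Set (K →ₗ[R] ℳ)) := by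
      rw [← hT]
      exact Submodule.subset_span ⟨n', w, hw, rfl⟩
    obtain ⟨s, hs1, hs⟩ := Submodule.mem_span_finset.1 hwG
    have hw' : w = ∑ t ∈ T, gproj ℬ n' ∘ₗ (s t • t) := by
      have : w = gproj ℬ n' ∘ₗ ((ℬ n').subtype ∘ₗ w) := by
        ext k
        simp [gproj_same ℬ _ (w k).2]
      rw [this, ← hs]
      ext k
      simp [LinearMap.sum_apply]
    rw [hw']
    refine Submodule.sum_mem _ fun t ht => ?_
    have htG : t ∈ G := hTG ht
    set d := deg t with hd
    let m1 : Fin r → ℕ := fun i => (n' i - n i).toNat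
    let m2 : Fin r → ℕ := fun i => (n i - d i).toNat
    have e2 : n = fun i => d i + m2 i := by
      ext i
      have : d i ≤ c i := hc t ht i
      have h2 := hcn i
      simp only [m2] at *
      omega
    have e1 : n' = fun i => n i + m1 i := by
      ext i
      have h2 := hnn' i
      simp only [m1] at *
      omega
    have e3 : n' = fun i => d i + ((m1 + m2) i : ℕ) := by
      ext i
      have h1 := congrFun e1 i
      have h2 := congrFun e2 i
      simp only [Pi.add_apply] at *
      push_cast
      omega
    have htk : ∀ k, t k = (v t k : ℳ) := by
      intro k
      conv_lhs => rw [hvw t htG]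
      rfl
    have e4 : gproj ℬ n' ∘ₗ (s t • t) =
        gproj ℬ n' ∘ₗ ((DirectSum.decompose 𝒜 (s t) (m1 + m2) : S) • t) := by
      ext1 k
      simp only [LinearMap.comp_apply, LinearMap.smul_apply]
      rw [htk]
      exact gproj_smul 𝒜 ℬ hsmul d (m1 + m2) (s t) _ (v t k).2 n' e3
    rw [e4]
    have hmem : (DirectSum.decompose 𝒜 (s t) (m1 + m2) : S) ∈ 𝒜 m1 * 𝒜 m2 := by
      rw [← hadd]; exact SetLike.coe_mem _
    generalize (DirectSum.decompose 𝒜 (s t) (m1 + m2) : S) = z at hmem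
    induction hmem using Submodule.mul_induction_on' with
    | mem_mul_mem a ha b hb =>
      let φb : ℬ d →ₗ[R] ℬ n :=
        gproj ℬ n ∘ₗ (Module.toModuleEnd R (S := S) ℳ b : ℳ →ₗ[R] ℳ) ∘ₗ (ℬ d).subtype
      let φa : ℬ n →ₗ[R] ℬ n' :=
        gproj ℬ n' ∘ₗ (Module.toModuleEnd R (S := S) ℳ a : ℳ →ₗ[R] ℳ) ∘ₗ (ℬ n).subtype
      have h1 : φa ∘ₗ (φb ∘ₗ v t) ∈ p (ℬ n') := hp _ _ _ _ (h (hq _ _ _ _ (hv t htG)))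
      convert h1 using 1
      ext1 k
      have h2 := hsmul m2 d b (v t k) hb (v t k).2
      rw [← e2] at h2
      simp only [LinearMap.comp_apply, LinearMap.smul_apply, φa, φb]
      rw [htk]
      simp [gproj_same ℬ _ h2, mul_smul]
    | add a _ b _ ha hb =>
      have : gproj ℬ n' ∘ₗ ((a + b) • t) = gproj ℬ n' ∘ₗ (a • t) + gproj ℬ n' ∘ₗ (b • t) := by
        ext1 k
        simp [add_smul]
      rw [this]
      exact Submodule.add_mem _ ha hb
  by_cases hex : ∃ n : Fin r → ℤ, (fun i => (c i : ℤ)) ≤ n ∧ q (ℬ n) ≤ p (ℬ n)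
  · obtain ⟨n, hn, hqp⟩ := hex
    have hnn : (fun i => ((n i).toNat : ℤ)) = n := by
      ext i
      have := hn i
      simp only at this
      omega
    refine ⟨fun i => (n i).toNat, fun n' hn' => ?_⟩
    rw [hnn] at hn' ⊢
    exact ⟨fun _ => hqp, fun _ => up n n' hn hn' hqp⟩
  · push Not at hex
    exact ⟨c, fun n hn => ⟨fun h => absurd h (hex n hn), fun h => absurd h (hex _ le_rfl)⟩⟩

lemma EvConst.and {P Q : (Fin r → ℤ) → Prop} (hP : EvConst P) (hQ : EvConst Q) :
    EvConst (fun n => P n ∧ Q n) := by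
  obtain ⟨c, hc⟩ := hP
  obtain ⟨d, hd⟩ := hQ
  refine ⟨c ⊔ d, fun n hn => ?_⟩
  have h1 : (fun i => (c i : ℤ)) ≤ (fun i => (((c ⊔ d) i : ℕ) : ℤ)) := fun i => by simp
  have h2 : (fun i => (d i : ℤ)) ≤ (fun i => (((c ⊔ d) i : ℕ) : ℤ)) := fun i => by simp
  simp only
  rw [hc n (h1.trans hn), hd n (h2.trans hn), hc _ h1, hd _ h2]

lemma EvConst.forall_lt {P : ℕ → (Fin r → ℤ) → Prop} (hP : ∀ i, EvConst (P i)) (N : ℕ) :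
    EvConst (fun n => ∀ i < N, P i n) := by
  induction N with
  | zero => exact ⟨0, by simp⟩
  | succ N ih =>
    have := ih.and (hP N)
    convert this using 2 with n
    constructor
    · intro h
      exact ⟨fun i hi => h i (by omega), h N (by omega)⟩
    · rintro ⟨h1, h2⟩ i hi
      rcases Nat.lt_succ_iff_lt_or_eq.1 hi with h | rfl
      · exact h1 i h
      · exact h2

lemma EvConst.uniform {P : ℕ → (Fin r → ℤ) → Prop} (hP : ∀ i, EvConst (P i)) (N : ℕ) :
    ∃ c : Fin r → ℕ, ∀ i < N, ∀ n : Fin r → ℤ, (fun i => (c i : ℤ)) ≤ n →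
      (P i n ↔ P i (fun i => (c i : ℤ))) := by
  choose c hc using hP
  refine ⟨fun j => (Finset.range N).sup (fun i => c i j), fun i hi n hn => ?_⟩
  have h1 : (fun j => (c i j : ℤ)) ≤
      (fun j => (((Finset.range N).sup (fun i => c i j) : ℕ) : ℤ)) := fun j => by
    have := Finset.le_sup (f := fun i => c i j) (Finset.mem_range.2 hi)
    exact Int.ofNat_le.2 this
  rw [hc i n (h1.trans hn), hc i _ h1]

end graded


section hom
variable {R : Type u} [CommRing R]

/-- vanishing of `Ext^i(Y, X)` -/
def VExt (R : Type u) [CommRing R] (Y : Type u) [AddCommGroup Y] [Module R Y]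
    (X : Type u) [AddCommGroup X] [Module R X] (i : ℕ) : Prop :=
  ∀ e : Abelian.Ext (ModuleCat.of R Y) (ModuleCat.of R X) i, e = 0

section les
variable {N₁ N₂ N₃ : Type u} [AddCommGroup N₁] [Module R N₁] [AddCommGroup N₂] [Module R N₂]
  [AddCommGroup N₃] [Module R N₃] {f : N₁ →ₗ[R] N₂} {g : N₂ →ₗ[R] N₃}
  (X : Type u) [AddCommGroup X] [Module R X]

lemma sesMk (hf : Function.Injective f) (hg : Function.Surjective g) (hfg : Function.Exact f g) :
    (ModuleCat.shortComplexOfCompEqZero f g hfg.linearMap_comp_eq_zero).ShortExact :=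
  ModuleCat.shortComplex_shortExact _ hfg hf hg

lemma VExt.mid (hf : Function.Injective f) (hg : Function.Surjective g) (hfg : Function.Exact f g)
    {i : ℕ} (h1 : VExt R N₁ X i) (h3 : VExt R N₃ X i) : VExt R N₂ X i := by
  intro e
  obtain ⟨y, rfl⟩ := Abelian.Ext.contravariant_sequence_exact₂ (sesMk hf hg hfg) _ e (h1 _)
  rw [h3 y, Abelian.Ext.comp_zero]

lemma VExt.left (hf : Function.Injective f) (hg : Function.Surjective g) (hfg : Function.Exact f g)
    {i : ℕ} (h2 : VExt R N₂ X i) (h3 : VExt R N₃ X (i + 1)) : VExt R N₁ X i := by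
  intro e
  obtain ⟨y, rfl⟩ := Abelian.Ext.contravariant_sequence_exact₁ (sesMk hf hg hfg) _ e
    (add_comm 1 i) (h3 _)
  rw [h2 y, Abelian.Ext.comp_zero]

lemma VExt.right (hf : Function.Injective f) (hg : Function.Surjective g)
    (hfg : Function.Exact f g)
    {i : ℕ} (h1 : VExt R N₁ X i) (h2 : VExt R N₂ X (i + 1)) : VExt R N₃ X (i + 1) := by
  intro e
  obtain ⟨y, rfl⟩ := Abelian.Ext.contravariant_sequence_exact₃ (sesMk hf hg hfg) _ e
    (h2 _) (add_comm 1 i)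
  rw [h1 y, Abelian.Ext.comp_zero]

lemma VExt.extend (hf : Function.Injective f) (hg : Function.Surjective g)
    (hfg : Function.Exact f g) (h3 : VExt R N₃ X 1) (φ : N₁ →ₗ[R] X) :
    ∃ ψ : N₂ →ₗ[R] X, ψ ∘ₗ f = φ := by
  obtain ⟨y, hy⟩ := Abelian.Ext.contravariant_sequence_exact₁ (sesMk hf hg hfg) (ModuleCat.of R X)
    (Abelian.Ext.mk₀ (ModuleCat.ofHom φ)) (add_comm 1 0) (h3 _)
  obtain ⟨ψ, rfl⟩ := (Abelian.Ext.mk₀_bijective _ _).2 y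
  rw [Abelian.Ext.mk₀_comp_mk₀, (Abelian.Ext.mk₀_bijective _ _).1.eq_iff] at hy
  exact ⟨ψ.hom, congrArg ModuleCat.Hom.hom hy⟩

lemma VExt.of_extend (hf : Function.Injective f) (hg : Function.Surjective g)
    (hfg : Function.Exact f g) (h2 : VExt R N₂ X 1)
    (h : ∀ (φ : N₁ →ₗ[R] X), ∃ ψ : N₂ →ₗ[R] X, ψ ∘ₗ f = φ) : VExt R N₃ X 1 := by
  intro e
  obtain ⟨y, rfl⟩ := Abelian.Ext.contravariant_sequence_exact₃ (sesMk hf hg hfg) _ e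
    (h2 _) (add_comm 1 0)
  obtain ⟨φ, rfl⟩ := (Abelian.Ext.mk₀_bijective _ _).2 y
  obtain ⟨ψ, hψ⟩ := h φ.hom
  have : φ = (ModuleCat.shortComplexOfCompEqZero f g hfg.linearMap_comp_eq_zero).f ≫
      ModuleCat.ofHom ψ := by
    ext1
    exact hψ.symm
  rw [this, ← Abelian.Ext.mk₀_comp_mk₀]
  exact ShortComplex.ShortExact.extClass_comp_assoc (sesMk hf hg hfg) _

end les

lemma VExt.proj (Y : Type u) [AddCommGroup Y] [Module R Y] [Module.Projective R Y]
    (X : Type u) [AddCommGroup X] [Module R X] (i : ℕ) : VExt R Y X (i + 1) := by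
  intro e
  exact e.eq_zero_of_projective

lemma VExt.sub (Y : Type u) [AddCommGroup Y] [Module R Y] [Subsingleton Y]
    (X : Type u) [AddCommGroup X] [Module R X] (i : ℕ) : VExt R Y X i := by
  intro e
  have : (𝟙 (ModuleCat.of R Y)) = 0 := by
    ext x; exact Subsingleton.elim (α := Y) _ _
  rw [← e.mk₀_id_comp, this]
  simp

lemma VExt.congr {Y Y' : Type u} [AddCommGroup Y] [Module R Y] [AddCommGroup Y'] [Module R Y']
    (f : Y ≃ₗ[R] Y')
    (X : Type u) [AddCommGroup X] [Module R X] {i : ℕ} (h : VExt R Y X i) : VExt R Y' X i :=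
  VExt.mid (f := f.toLinearMap) (g := (0 : Y' →ₗ[R] PUnit.{u+1})) X f.injective
    (Function.surjective_to_subsingleton _)
    ((f.exact_zero_iff_surjective _).2 f.surjective) h (VExt.sub _ _ _)

/-- syzygy description -/
lemma exists_syzygy [IsNoetherianRing R] (i : ℕ) (Y : Type u) [AddCommGroup Y] [Module R Y]
    [Module.Finite R Y] :
    ∃ (P : Type u) (_ : AddCommGroup P) (_ : Module R P) (Z : Submodule R P),
      Module.Finite R P ∧ ∀ (X : Type u) [AddCommGroup X] [Module R X],
        VExt R Y X (i + 1) ↔ ∀ φ : Z →ₗ[R] X, ∃ ψ : P →ₗ[R] X, ψ ∘ₗ Z.subtype = φ := by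
  induction i generalizing Y with
  | zero =>
    obtain ⟨P, _, _, _, _, f, hf⟩ := Module.exists_finite_presentation R Y
    refine ⟨P, inferInstance, inferInstance, LinearMap.ker f, inferInstance, fun X _ _ => ⟨?_, ?_⟩⟩
    · exact fun h => VExt.extend X (Submodule.injective_subtype _) hf (f.exact_subtype_ker_map) h
    · exact fun h => VExt.of_extend X (Submodule.injective_subtype _) hf (f.exact_subtype_ker_map)
        (VExt.proj _ _ _) h
  | succ i ih =>
    obtain ⟨P, _, _, _, _, f, hf⟩ := Module.exists_finite_presentation R Y
    obtain ⟨P', i1, i2, Z, hP', hZ⟩ := ih (LinearMap.ker f)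
    refine ⟨P', i1, i2, Z, hP', fun X _ _ => ?_⟩
    rw [← hZ X]
    constructor
    · exact fun h => VExt.left X (Submodule.injective_subtype _) hf (f.exact_subtype_ker_map)
        (VExt.proj _ _ _) h
    · exact fun h => VExt.right X (Submodule.injective_subtype _) hf (f.exact_subtype_ker_map)
        h (VExt.proj _ _ _)

/-- injective dimension at most `m` -/
def IdLE (R : Type u) [CommRing R] (X : Type u) [AddCommGroup X] [Module R X] (m : ℕ) : Prop :=
  ∀ i, m + 1 ≤ i → ∀ (Y : Type u) [AddCommGroup Y] [Module R Y], VExt R Y X i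

lemma idLE_of_ideal (m : ℕ) (X : ModuleCat.{u} R)
    (h : ∀ I : Ideal R, VExt R (R ⧸ I) X (m + 1)) : HasInjectiveDimensionLE X m := by
  induction m generalizing X with
  | zero =>
    rw [HasInjectiveDimensionLE, zero_add, ← injective_iff_hasInjectiveDimensionLT_one,
      ← Module.injective_iff_injective_object R X, ← Module.Baer.iff_injective]
    intro I φ
    obtain ⟨ψ, hψ⟩ := VExt.extend X (f := I.subtype) (g := I.mkQ) (Submodule.injective_subtype _)
      (Submodule.mkQ_surjective _) (LinearMap.exact_subtype_mkQ _) (h I) φ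
    exact ⟨ψ, fun x hx => LinearMap.congr_fun hψ ⟨x, hx⟩⟩
  | succ m ih =>
    let ⟨I, _, f, _⟩ := EnoughInjectives.presentation X
    have injf : Function.Injective f.hom := (ModuleCat.mono_iff_injective f).mp ‹_›
    let S : ShortComplex (ModuleCat.{u} R) :=
      ModuleCat.shortComplexOfCompEqZero _ _ f.hom.exact_map_mkQ_range.linearMap_comp_eq_zero
    have exactS : S.ShortExact := ModuleCat.shortComplex_shortExact S
      f.hom.exact_map_mkQ_range injf (Submodule.mkQ_surjective _)
    refine (exactS.hasInjectiveDimensionLT_X₃_iff m inferInstance).1 ?_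
    apply ih
    intro J e
    obtain ⟨y, hy⟩ := Abelian.Ext.covariant_sequence_exact₃ _ exactS e rfl (h J _)
    rw [← hy, Abelian.Ext.eq_zero_of_injective y, Abelian.Ext.zero_comp]

lemma idLE_iff (m : ℕ) (X : ModuleCat.{u} R) : IdLE R X m ↔ HasInjectiveDimensionLE X m := by
  rw [HasInjectiveDimensionLE, hasInjectiveDimensionLT_iff]
  exact ⟨fun h i hi Y e => h i hi Y e, fun h i hi Y _ _ e => h i hi e⟩

lemma old_ext_iff (Y X : ModuleCat.{u} R) (m : ℕ) :
    Subsingleton ↥(((Ext R (ModuleCat.{u} R) (m + 1)).obj (Opposite.op Y)).obj X) ↔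
    Subsingleton (Abelian.Ext Y X (m + 1)) := by
  let P := ProjectiveResolution.of Y
  have h1 : Subsingleton (Abelian.Ext Y X (m + 1)) ↔
      ∀ f : P.complex.X (m + 1) ⟶ X, P.complex.d (m + 2) (m + 1) ≫ f = 0 →
        ∃ g : P.complex.X m ⟶ X, P.complex.d (m + 1) m ≫ g = f := by
    constructor
    · intro h f hf
      exact (P.extMk_eq_zero_iff f (m + 2) rfl hf m rfl).1 (Subsingleton.elim _ _)
    · intro h
      refine subsingleton_of_forall_eq 0 fun e => ?_
      obtain ⟨f, hf, rfl⟩ := P.extMk_surjective e (m + 2) rfl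
      exact (P.extMk_eq_zero_iff f (m + 2) rfl hf m rfl).2 (h f hf)
  rw [h1]
  have e := P.isoExt (R := R) (m + 1) X
  rw [← ModuleCat.isZero_iff_subsingleton, e.isZero_iff,
    ← HomologicalComplex.exactAt_iff_isZero_homology,
    HomologicalComplex.exactAt_iff' _ m (m + 1) (m + 2) (by simp) (by simp),
    ShortComplex.moduleCat_exact_iff]
  rfl

lemma quot_ann (I : Ideal R) {x : R} (hx : x ∈ I) (y : R ⧸ I) : x • y = 0 := by
  obtain ⟨z, rfl⟩ := Ideal.Quotient.mk_surjective y
  rw [← Ideal.Quotient.mk_eq_mk, ← Submodule.Quotient.mk_smul, Submodule.Quotient.mk_eq_zero]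
  exact I.mul_mem_right z hx

/-- the sequence `R/I → R/I → R/(I + x)` -/
lemma quot_seq (I : Ideal R) (x : R) :
    Function.Exact (x • (LinearMap.id : (R ⧸ I) →ₗ[R] (R ⧸ I)))
      (Submodule.factor (le_sup_left : I ≤ I ⊔ Ideal.span {x})) := by
  intro y
  obtain ⟨z, rfl⟩ := Submodule.mkQ_surjective _ y
  have key : (Submodule.factor (le_sup_left : I ≤ I ⊔ Ideal.span {x})) (I.mkQ z) = 0 ↔
      z ∈ I ⊔ Ideal.span {x} := Submodule.Quotient.mk_eq_zero (I ⊔ Ideal.span {x})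
  rw [key, Submodule.mkQ_apply]
  constructor
  · intro h
    obtain ⟨a, ha, b, hb, rfl⟩ := Submodule.mem_sup.1 h
    obtain ⟨c, rfl⟩ := Ideal.mem_span_singleton'.1 hb
    refine ⟨Submodule.Quotient.mk c, ?_⟩
    simp only [LinearMap.smul_apply, LinearMap.id_apply]
    rw [← Submodule.Quotient.mk_smul, Submodule.Quotient.eq]
    have : x • c - (a + c * x) = - a := by simp [mul_comm]
    rw [this]
    exact I.neg_mem ha
  · rintro ⟨w, hw⟩
    obtain ⟨c, rfl⟩ := Submodule.mkQ_surjective _ w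
    simp only [LinearMap.smul_apply, LinearMap.id_apply, Submodule.mkQ_apply] at hw
    rw [← Submodule.Quotient.mk_smul, Submodule.Quotient.eq] at hw
    have h2 : z = x • c - (x • c - z) := by ring
    rw [h2]
    refine Ideal.sub_mem _ ?_ (le_sup_left (a := I) hw)
    exact le_sup_right (a := I) (Ideal.mul_mem_right c _ (Ideal.mem_span_singleton_self x))

section loc
variable [IsNoetherianRing R] [IsLocalRing R]

lemma VExt.nakayama {N N₃ : Type u} [AddCommGroup N] [Module R N]
    [AddCommGroup N₃] [Module R N₃] [Module.Finite R N] (x : R)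
    (hx : x ∈ IsLocalRing.maximalIdeal R) {g : N →ₗ[R] N₃}
    (X : Type u) [AddCommGroup X] [Module R X] [Module.Finite R X]
    (hf : Function.Injective (x • (LinearMap.id : N →ₗ[R] N))) (hg : Function.Surjective g)
    (hfg : Function.Exact (x • (LinearMap.id : N →ₗ[R] N)) g)
    {i : ℕ} (h3 : VExt R N₃ X (i + 1)) : VExt R N X i := by
  have hfin : Module.Finite R (Abelian.Ext (ModuleCat.of R N) (ModuleCat.of R X) i) :=
    ModuleCat.finite_ext R (ModuleCat.of R N) (ModuleCat.of R X) i
  have hsub : (⊤ : Submodule R (Abelian.Ext (ModuleCat.of R N) (ModuleCat.of R X) i)) = ⊥ := by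
    refine Submodule.eq_bot_of_le_smul_of_le_jacobson_bot (IsLocalRing.maximalIdeal R) _
      hfin.fg_top ?_ (IsLocalRing.maximalIdeal_le_jacobson _)
    intro e _
    obtain ⟨y, rfl⟩ := Abelian.Ext.contravariant_sequence_exact₁ (sesMk hf hg hfg) _ e
      (add_comm 1 i) (h3 _)
    have : (ModuleCat.shortComplexOfCompEqZero _ g hfg.linearMap_comp_eq_zero).f =
      x • 𝟙 (ModuleCat.of R N) := rfl
    rw [this, Abelian.Ext.mk₀_smul, Abelian.Ext.smul_comp, Abelian.Ext.mk₀_id_comp]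
    exact Submodule.smul_mem_smul hx trivial
  intro e
  have : e ∈ (⊤ : Submodule R (Abelian.Ext (ModuleCat.of R N) (ModuleCat.of R X) i)) := trivial
  rw [hsub] at this
  exact this

/-- devissage -/
lemma VExt.devissage (X : Type u) [AddCommGroup X] [Module R X] (i : ℕ) (I : Ideal R)
    (h : ∀ p : PrimeSpectrum R, I ≤ p.asIdeal → VExt R (R ⧸ p.asIdeal) X i)
    (N : Type u) [AddCommGroup N] [Module R N] (hN : Module.Finite R N)
    (hI : ∀ x ∈ I, ∀ y : N, x • y = 0) : VExt R N X i := by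
  induction hN using IsNoetherianRing.induction_on_isQuotientEquivQuotientPrime R with
  | subsingleton N => exact VExt.sub _ _ _
  | quotient N p e =>
    refine VExt.congr e.symm X (h p ?_)
    intro x hx
    have h1 := hI x hx (e.symm (Ideal.Quotient.mk _ 1))
    rw [← map_smul, LinearEquiv.map_eq_zero_iff, ← Ideal.Quotient.mk_eq_mk,
      ← Submodule.Quotient.mk_smul, Submodule.Quotient.mk_eq_zero] at h1
    simpa using h1
  | exact N₁ N₂ N₃ f g hf hg hfg h1 h3 =>
    refine VExt.mid X hf hg hfg (h1 ?_) (h3 ?_)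
    · intro x hx y
      apply hf
      rw [map_smul, map_zero, hI x hx]
    · intro x hx y
      obtain ⟨z, rfl⟩ := hg y
      rw [← map_smul, hI x hx, map_zero]

lemma exists_dim (R : Type u) [CommRing R] [IsNoetherianRing R] [IsLocalRing R] :
    ∃ D : ℕ, ∀ p : PrimeSpectrum R, Order.coheight p ≤ D := by
  have h : ringKrullDim R < ⊤ := ringKrullDim_lt_top
  have h0 : ringKrullDim R ≠ ⊥ := ringKrullDim_ne_bot
  obtain ⟨d, hd⟩ := WithBot.ne_bot_iff_exists.1 h0
  have hd' : d ≠ ⊤ := by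
    rintro rfl
    rw [← hd] at h
    exact absurd h (lt_irrefl _)
  obtain ⟨D, rfl⟩ := ENat.ne_top_iff_exists.1 hd'
  refine ⟨D, fun p => ?_⟩
  have := Order.coheight_le_krullDim p
  change _ ≤ ringKrullDim R at this
  rw [← hd] at this
  exact WithBot.coe_le_coe.1 this

lemma prime_vanish (D : ℕ) (m : ℕ) (X : Type u) [AddCommGroup X] [Module R X] [Module.Finite R X]
    (h : ∀ i, m + 1 ≤ i → i ≤ m + 1 + D → VExt R (IsLocalRing.ResidueField R) X i)
    (t : ℕ) (ht : t ≤ D) (p : PrimeSpectrum R) (hp : Order.coheight p ≤ t) (i : ℕ)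
    (hi : m + 1 ≤ i) (hi' : i + t ≤ m + 1 + D) : VExt R (R ⧸ p.asIdeal) X i := by
  induction t generalizing p i with
  | zero =>
    by_cases hpm : p.asIdeal = IsLocalRing.maximalIdeal R
    · rw [hpm]; exact h i hi (by omega)
    · exfalso
      have hlt : p < IsLocalRing.closedPoint R :=
        lt_of_le_of_ne (IsLocalRing.le_maximalIdeal p.2.ne_top) (fun h => hpm (by rw [h]; rfl))
      have := (Order.coheight_add_one_le hlt).trans hp
      simp at this
  | succ t ih =>
    by_cases hpm : p.asIdeal = IsLocalRing.maximalIdeal R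
    · rw [hpm]; exact h i hi (by omega)
    · have hlt : p.asIdeal < IsLocalRing.maximalIdeal R :=
        lt_of_le_of_ne (IsLocalRing.le_maximalIdeal p.2.ne_top) hpm
      obtain ⟨x, hxm, hxp⟩ := SetLike.exists_of_lt hlt
      refine VExt.nakayama (N₃ := R ⧸ (p.asIdeal ⊔ Ideal.span {x})) x hxm X ?_
        (Submodule.factor_surjective _)
        (quot_seq p.asIdeal x) ?_
      · rw [← LinearMap.ker_eq_bot, LinearMap.ker_eq_bot']
        intro y hy
        obtain ⟨z, rfl⟩ := Submodule.mkQ_surjective _ y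
        simp only [LinearMap.smul_apply, LinearMap.id_apply, Submodule.mkQ_apply] at hy ⊢
        rw [← Submodule.Quotient.mk_smul, Submodule.Quotient.mk_eq_zero] at hy
        rw [Submodule.Quotient.mk_eq_zero]
        exact (p.2.mem_or_mem hy).resolve_left hxp
      · refine VExt.devissage X (i + 1) (p.asIdeal ⊔ Ideal.span {x}) ?_ _ inferInstance
          (fun y hy z => quot_ann _ hy z)
        intro q hq
        refine ih (by omega) q ?_ (i + 1) (by omega) (by omega)
        have hpq : p < q := by
          refine lt_of_le_of_ne (le_sup_left.trans hq) ?_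
          rintro rfl
          exact hxp (hq (le_sup_right (a := p.asIdeal) (Ideal.mem_span_singleton_self x)))
        have := (Order.coheight_add_one_le hpq).trans hp
        push_cast at this
        exact (ENat.add_le_add_iff_right ENat.one_ne_top).1 this

lemma idLE_of_residue {D : ℕ} (hD : ∀ p : PrimeSpectrum R, Order.coheight p ≤ D)
    (m : ℕ) (X : Type u) [AddCommGroup X] [Module R X] [Module.Finite R X]
    (h : ∀ i, m + 1 ≤ i → i ≤ m + 1 + D → VExt R (IsLocalRing.ResidueField R) X i) :
    IdLE R X m := by
  refine (idLE_iff m (ModuleCat.of R X)).2 (idLE_of_ideal m _ fun I => ?_)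
  refine VExt.devissage X (m + 1) ⊥ ?_ _ inferInstance ?_
  · intro p _
    exact prime_vanish D m X h D le_rfl p (hD p) (m + 1) le_rfl le_rfl
  · intro x hx y
    rw [Ideal.mem_bot.1 hx, zero_smul]

lemma exists_good_ideal (R : Type u) [CommRing R] [IsNoetherianRing R] [IsLocalRing R] :
    ∃ (I : Ideal R) (B : ℕ) (j : IsLocalRing.ResidueField R →ₗ[R] (R ⧸ I)),
      Function.Injective j ∧
      ∀ (X : Type u) [AddCommGroup X] [Module R X] (i : ℕ), B < i → VExt R (R ⧸ I) X i := by
  let s : Set (Ideal R) := {I | I ≠ ⊤ ∧ ∃ B : ℕ,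
    ∀ (X : Type u) [AddCommGroup X] [Module R X] (i : ℕ), B < i → VExt R (R ⧸ I) X i}
  have hs : s.Nonempty := by
    refine ⟨⊥, bot_ne_top, 0, fun X _ _ i hi => ?_⟩
    obtain ⟨i, rfl⟩ : ∃ k, i = k + 1 := ⟨i - 1, by omega⟩
    exact VExt.congr (Submodule.quotEquivOfEqBot (⊥ : Ideal R) rfl).symm X (VExt.proj R X i)
  obtain ⟨I, ⟨hI, B, hB⟩, hmax⟩ := WellFounded.has_min
    (wellFounded_gt : WellFounded ((· > ·) : Ideal R → Ideal R → Prop)) s hs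
  by_cases hsub : Subsingleton (IsLocalRing.ResidueField R →ₗ[R] (R ⧸ I))
  · exfalso
    obtain ⟨x, hx, hreg⟩ := IsSMulRegular.subsingleton_linearMap_iff.1 hsub
    have hxm : x ∈ IsLocalRing.maximalIdeal R := by
      have h1 := Module.mem_annihilator.1 hx (1 : IsLocalRing.ResidueField R)
      rw [← IsLocalRing.residue_eq_zero_iff]
      rw [Algebra.smul_def, mul_one] at h1
      exact h1
    have hxI : x ∉ I := by
      intro hxI
      have : Nontrivial (R ⧸ I) := Ideal.Quotient.nontrivial_iff.2 hI
      have h1 : x • (1 : R ⧸ I) = x • (0 : R ⧸ I) := by rw [quot_ann I hxI, smul_zero]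
      exact one_ne_zero (hreg h1)
    refine hmax (I ⊔ Ideal.span {x}) ⟨?_, B + 1, fun X _ _ i hi => ?_⟩ ?_
    · have : I ⊔ Ideal.span {x} ≤ IsLocalRing.maximalIdeal R :=
        sup_le (IsLocalRing.le_maximalIdeal hI) ((Ideal.span_singleton_le_iff_mem _).2 hxm)
      intro htop
      rw [htop, top_le_iff] at this
      exact (IsLocalRing.maximalIdeal.isMaximal R).ne_top this
    · obtain ⟨i, rfl⟩ : ∃ k, i = k + 1 := ⟨i - 1, by omega⟩
      exact VExt.right X (f := x • (LinearMap.id : (R ⧸ I) →ₗ[R] (R ⧸ I))) hreg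
        (Submodule.factor_surjective _)
        (quot_seq I x) (hB X i (by omega)) (hB X (i + 1) (by omega))
    · refine lt_of_le_of_ne le_sup_left fun h => hxI ?_
      rw [h]
      exact le_sup_right (a := I) (Ideal.mem_span_singleton_self x)
  · rw [not_subsingleton_iff_nontrivial] at hsub
    obtain ⟨j, hj⟩ := exists_ne (0 : IsLocalRing.ResidueField R →ₗ[R] (R ⧸ I))
    refine ⟨I, B, j, ?_, hB⟩
    have : IsSimpleModule R (IsLocalRing.ResidueField R) := 
      isSimpleModule_iff_isCoatom.2 (IsLocalRing.maximalIdeal.isMaximal R).out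
    exact (LinearMap.injective_or_eq_zero j).resolve_right hj

lemma exists_bound (R : Type u) [CommRing R] [IsNoetherianRing R] [IsLocalRing R] :
    ∃ B : ℕ, ∀ (X : Type u) [AddCommGroup X] [Module R X] [Module.Finite R X] (m : ℕ),
      IdLE R X m → IdLE R X B := by
  obtain ⟨D, hD⟩ := exists_dim R
  obtain ⟨I, B, j, hj, hB⟩ := exists_good_ideal R
  refine ⟨B, fun X _ _ _ m hm => ?_⟩
  have step : ∀ k, IdLE R X (B + k) → IdLE R X B := by
    intro k
    induction k with
    | zero => exact id
    | succ k ih =>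
      intro h
      apply ih
      apply idLE_of_residue hD
      intro i hi _
      by_cases h' : B + k + 1 < i
      · exact h i (by omega) _
      · obtain rfl : i = B + k + 1 := by omega
        exact VExt.left X hj (Submodule.mkQ_surjective _) j.exact_map_mkQ_range
          (hB X _ (by omega)) (h _ (by omega) _)
  refine step m ?_
  intro i hi
  exact hm i (by omega)

end loc
end hom

section coh
variable {R : Type u} [CommRing R]
variable {K L : Type u} [AddCommGroup K] [Module R K] [AddCommGroup L] [Module R L]
  (f : K →ₗ[R] L)

/-- functoriality of the coherent functor -/
noncomputable def cohMap {X Y : Type u} [AddCommGroup X] [Module R X] [AddCommGroup Y] [Module R Y]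
    (φ : X →ₗ[R] Y) : coherentApply f X →ₗ[R] coherentApply f Y :=
  Submodule.mapQ _ _ (LinearMap.compRight R φ) (by
    rintro _ ⟨g, rfl⟩
    exact ⟨φ ∘ₗ g, rfl⟩)

/-- the comparison map -/
noncomputable def cohTheta (A : Type u) [AddCommGroup A] [Module R A]
    (X : Type u) [AddCommGroup X] [Module R X] :
    (TensorProduct R A K →ₗ[R] X) →ₗ[R] (A →ₗ[R] coherentApply f X) where
  toFun w := (LinearMap.range (LinearMap.lcomp R X f)).mkQ ∘ₗ TensorProduct.curry w
  map_add' w w' := by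
    ext a
    rfl
  map_smul' c w := by
    ext a
    rfl

lemma cohTheta_nat (A : Type u) [AddCommGroup A] [Module R A]
    (X Y : Type u) [AddCommGroup X] [Module R X] [AddCommGroup Y] [Module R Y]
    (φ : X →ₗ[R] Y) (w : TensorProduct R A K →ₗ[R] X) :
    cohTheta f A Y (φ ∘ₗ w) = cohMap f φ ∘ₗ cohTheta f A X w := by
  ext a
  rfl

lemma cohTheta_surj (A : Type u) [AddCommGroup A] [Module R A] [Module.Projective R A]
    (X : Type u) [AddCommGroup X] [Module R X] : Function.Surjective (cohTheta f A X) := by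
  intro g
  obtain ⟨h, hh⟩ := Module.projective_lifting_property
    (LinearMap.range (LinearMap.lcomp R X f)).mkQ g (Submodule.mkQ_surjective _)
  refine ⟨TensorProduct.lift h, ?_⟩
  rw [← hh]
  ext a
  rfl

/-- maps whose image under theta factors through `s` -/
noncomputable def cohSub (A B : Type u) [AddCommGroup A] [Module R A] [AddCommGroup B] [Module R B]
    (s : A →ₗ[R] B) (X : Type u) [AddCommGroup X] [Module R X] :
    Submodule R (TensorProduct R A K →ₗ[R] X) :=
  (LinearMap.range (LinearMap.lcomp R (coherentApply f X) s)).comap (cohTheta f A X)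

lemma mem_cohSub (A B : Type u) [AddCommGroup A] [Module R A] [AddCommGroup B] [Module R B]
    (s : A →ₗ[R] B) (X : Type u) [AddCommGroup X] [Module R X]
    (w : TensorProduct R A K →ₗ[R] X) :
    w ∈ cohSub f A B s X ↔ ∃ φ : B →ₗ[R] coherentApply f X, φ ∘ₗ s = cohTheta f A X w := Iff.rfl

lemma cohSub_nat (A B : Type u) [AddCommGroup A] [Module R A] [AddCommGroup B] [Module R B]
    (s : A →ₗ[R] B) (X Y : Type u) [AddCommGroup X] [Module R X] [AddCommGroup Y] [Module R Y]
    (φ : X →ₗ[R] Y) (w : TensorProduct R A K →ₗ[R] X) (hw : w ∈ cohSub f A B s X) :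
    φ ∘ₗ w ∈ cohSub f A B s Y := by
  rw [mem_cohSub] at hw ⊢
  obtain ⟨ψ, hψ⟩ := hw
  exact ⟨cohMap f φ ∘ₗ ψ, by rw [cohTheta_nat, ← hψ, LinearMap.comp_assoc]⟩

lemma cohSub_le (A B C : Type u) [AddCommGroup A] [Module R A] [AddCommGroup B] [Module R B]
    [AddCommGroup C] [Module R C] [Module.Projective R A]
    (s : A →ₗ[R] B) (hs : Function.Surjective s) (j : B →ₗ[R] C)
    (X : Type u) [AddCommGroup X] [Module R X] :
    cohSub f A B s X ≤ cohSub f A C (j ∘ₗ s) X ↔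
      ∀ φ : B →ₗ[R] coherentApply f X, ∃ ψ : C →ₗ[R] coherentApply f X, ψ ∘ₗ j = φ := by
  constructor
  · intro h φ
    obtain ⟨w, hw⟩ := cohTheta_surj f A X (φ ∘ₗ s)
    obtain ⟨ψ, hψ⟩ := (mem_cohSub f A C (j ∘ₗ s) X w).1
      (h ((mem_cohSub f A B s X w).2 ⟨φ, hw.symm⟩))
    refine ⟨ψ, ?_⟩
    rw [hw, ← LinearMap.comp_assoc] at hψ
    exact LinearMap.cancel_right hs |>.1 hψ
  · intro h w hw
    obtain ⟨φ, hφ⟩ := (mem_cohSub f A B s X w).1 hw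
    obtain ⟨ψ, rfl⟩ := h φ
    exact (mem_cohSub f A C (j ∘ₗ s) X w).2 ⟨ψ, by rw [← hφ, LinearMap.comp_assoc]⟩

lemma coh_finite [IsNoetherianRing R] [Module.Finite R K] (X : Type u) [AddCommGroup X]
    [Module R X] [IsNoetherian R X] : Module.Finite R (coherentApply f X) := by
  obtain ⟨a, s, hs⟩ := Module.Finite.exists_fin' R K
  have h1 : IsNoetherian R (K →ₗ[R] X) := by
    refine isNoetherian_of_injective
      (LinearMap.pi (fun i : Fin a => LinearMap.applyₗ (R := R) (M₂ := X)
        (s (Pi.single i 1))) : (K →ₗ[R] X) →ₗ[R] (Fin a → X)) ?_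
    intro g g' h
    rw [← LinearMap.cancel_right hs]
    refine LinearMap.pi_ext' fun i => LinearMap.ext_ring ?_
    exact congrFun h i
  infer_instance

lemma VExt_evConst [IsNoetherianRing R] [Module.Finite R K] {r : ℕ}
    {S : Type u} [CommRing S] [Algebra R S] [IsNoetherianRing S]
    (𝒜 : (Fin r → ℕ) → Submodule R S) [GradedAlgebra 𝒜]
    (hstd : ∀ n : Fin r → ℕ, 𝒜 n = ∏ i, 𝒜 (Pi.single i 1) ^ n i)
    {ℳ : Type u} [AddCommGroup ℳ] [Module R ℳ] [Module S ℳ]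
    [IsScalarTower R S ℳ] [Module.Finite S ℳ]
    (ℬ : (Fin r → ℤ) → Submodule R ℳ) [DirectSum.Decomposition ℬ]
    (hsmul : ∀ (m : Fin r → ℕ) (n : Fin r → ℤ) (s : S) (x : ℳ),
      s ∈ 𝒜 m → x ∈ ℬ n → s • x ∈ ℬ (fun i => n i + m i))
    (Y : Type u) [AddCommGroup Y] [Module R Y] [Module.Finite R Y] (i : ℕ) :
    EvConst (fun n => VExt R Y (coherentApply f (ℬ n)) (i + 1)) := by
  obtain ⟨P, _, _, Z, hP, h⟩ := exists_syzygy (R := R) i Y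
  obtain ⟨a, s, hs⟩ := Module.Finite.exists_fin' R Z
  have := core 𝒜 ℬ hstd hsmul (TensorProduct R (ULift.{u} (Fin a) → R) K)
    (fun X _ _ => cohSub f _ _ (s ∘ₗ (LinearEquiv.funCongrLeft R R Equiv.ulift.symm).toLinearMap) X)
    (fun X _ _ => cohSub f _ _ (Z.subtype ∘ₗ
      (s ∘ₗ (LinearEquiv.funCongrLeft R R Equiv.ulift.symm).toLinearMap)) X)
    (fun X Y _ _ _ _ φ w hw => cohSub_nat f _ _ _ X Y φ w hw)
    (fun X Y _ _ _ _ φ w hw => cohSub_nat f _ _ _ X Y φ w hw)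
  convert this using 2 with n
  rw [h, cohSub_le]
  exact hs.comp (LinearEquiv.surjective _)

end coh

lemma IdLE_iff_residue {R : Type u} [CommRing R] [IsNoetherianRing R] [IsLocalRing R] {D : ℕ}
    (hD : ∀ p : PrimeSpectrum R, Order.coheight p ≤ D)
    (m : ℕ) (X : Type u) [AddCommGroup X] [Module R X] [Module.Finite R X] :
    IdLE R X m ↔ ∀ i < D + 1, VExt R (IsLocalRing.ResidueField R) X (m + i + 1) := by
  constructor
  · intro h i _
    exact h _ (by omega) _
  · intro h
    refine idLE_of_residue hD m X fun i h1 h2 => ?_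
    obtain ⟨j, rfl⟩ := Nat.exists_eq_add_of_le h1
    have := h j (by omega)
    rwa [show m + j + 1 = m + 1 + j by omega] at this

lemma injDim_set_iff {R : Type u} [CommRing R] (X : Type u) [AddCommGroup X] [Module R X] (m : ℕ) :
    (∀ Y : ModuleCat.{u} R, Subsingleton ↥(((Ext R (ModuleCat.{u} R) (m + 1)).obj
      (Opposite.op Y)).obj (ModuleCat.of R X))) ↔ IdLE R X m := by
  constructor
  · intro h
    refine (idLE_iff m (ModuleCat.of R X)).2 (idLE_of_ideal m _ fun I e => ?_)
    have := (old_ext_iff _ _ m).1 (h (ModuleCat.of R (R ⧸ I)))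
    exact Subsingleton.elim _ _
  · intro h Y
    refine (old_ext_iff _ _ m).2 ⟨fun a b => ?_⟩
    rw [h (m + 1) le_rfl Y a, h (m + 1) le_rfl Y b]

lemma injDim_congr {R : Type u} [CommRing R] (X X' : Type u) [AddCommGroup X] [Module R X]
    [AddCommGroup X'] [Module R X'] (h : ∀ m, IdLE R X m ↔ IdLE R X' m) :
    injDim R X = injDim R X' := by
  unfold injDim
  simp only [injDim_set_iff, h]

/-- over a Noetherian local ring `R`, `id_R(F(ℳ_n))` is eventually
constant. -/
theorem stmt19 {R : Type u} [CommRing R] [IsNoetherianRing R] [IsLocalRing R]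
    {r : ℕ} (hr : 1 ≤ r)
    -- the Noetherian standard ℕ^r-graded ring S with S₀ = R
    (S : Type u) [CommRing S] [Algebra R S] [IsNoetherianRing S]
    (hinj : Function.Injective (algebraMap R S))
    (𝒜 : (Fin r → ℕ) → Submodule R S) [GradedAlgebra 𝒜]
    (h0 : 𝒜 0 = 1)
    (hstd : ∀ n : Fin r → ℕ, 𝒜 n = ∏ i, 𝒜 (Pi.single i 1) ^ n i)
    -- the finitely generated ℤ^r-graded S-module ℳ with components ℬ n
    (ℳ : Type u) [AddCommGroup ℳ] [Module R ℳ] [Module S ℳ]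
    [IsScalarTower R S ℳ] [Module.Finite S ℳ]
    (ℬ : (Fin r → ℤ) → Submodule R ℳ) (hdec : DirectSum.Decomposition ℬ)
    (hsmul : ∀ (m : Fin r → ℕ) (n : Fin r → ℤ) (s : S) (x : ℳ),
      s ∈ 𝒜 m → x ∈ ℬ n → s • x ∈ ℬ (fun i => n i + m i))
    -- the coherent functor
    {K L : Type u} [AddCommGroup K] [Module R K] [Module.Finite R K]
    [AddCommGroup L] [Module R L] [Module.Finite R L]
    (f : K →ₗ[R] L) :
    ∃ c : Fin r → ℕ, ∀ n : Fin r → ℤ, (fun i => (c i : ℤ)) ≤ n →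
      injDim R (coherentApply f (ℬ n)) =
      injDim R (coherentApply f (ℬ (fun i => (c i : ℤ)))) := by

  haveI := hdec
  have hfin : ∀ n, Module.Finite R (coherentApply f (ℬ n)) := fun n => by
    have := comp_noetherian 𝒜 ℬ h0 hsmul n
    exact coh_finite f (ℬ n)
  obtain ⟨D, hD⟩ := exists_dim R
  obtain ⟨B, hB⟩ := exists_bound R
  have hP : ∀ m, EvConst (fun n => IdLE R (coherentApply f (ℬ n)) m) := fun m => by
    have := EvConst.forall_lt (P := fun i n => VExt R (IsLocalRing.ResidueField R)
      (coherentApply f (ℬ n)) (m + i + 1))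
      (fun i => VExt_evConst f 𝒜 hstd ℬ hsmul _ (m + i)) (D + 1)
    convert this using 2 with n
    exact IdLE_iff_residue hD m _
  obtain ⟨c, hc⟩ := EvConst.uniform hP (B + 1)
  refine ⟨c, fun n hn => injDim_congr _ _ fun m => ?_⟩
  by_cases hm : m < B + 1
  · exact hc m hm n hn
  · have key : ∀ n, IdLE R (coherentApply f (ℬ n)) m ↔ IdLE R (coherentApply f (ℬ n)) B :=
      fun n => ⟨hB _ m, fun h i hi Y _ _ => h i (by omega) Y⟩
    rw [key, key]
    exact hc B (by omega) n hn
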